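/- Falb–Wolovich criterion (Proposition 2.7, full equivalence). Let A ∈ ℝ^{n×n}, B ∈ ℝ^{n×p}, C ∈ ℝ^{p×n} (the regular case m = p), with the convention d_i = n whenever C_i A^{j−1} B = 0 for all j ∈ {1,…,n}. There exist a matrix F ∈ ℝ^{p×n}, an invertible matrix G ∈ ℝ^{p×p}, and positive integers δ_1, …, δ_p such that over ℝ(s) the closed-loop transfer function C (sI − A − BF)⁻¹ B G equals diag(s^{−δ_1}, …, s^{−δ_p}) if and only if det B* ≠ 0. -/

import Mathlib

noncomputable section
open Matrix

/-- Entrywise embedding of a real matrix into matrices over the field ℝ(s). -/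
noncomputable def toRat {k l : ℕ} (M : Matrix (Fin k) (Fin l) ℝ) :
    Matrix (Fin k) (Fin l) (RatFunc ℝ) :=
  M.map (algebraMap ℝ (RatFunc ℝ))

/-- The matrix `s I - M` over ℝ(s). -/
noncomputable def sIm {k : ℕ} (M : Matrix (Fin k) (Fin k) ℝ) :
    Matrix (Fin k) (Fin k) (RatFunc ℝ) :=
  Matrix.scalar (Fin k) (RatFunc.X : RatFunc ℝ) - toRat M

theorem toRat_mul {k l m : ℕ} (M : Matrix (Fin k) (Fin l) ℝ) (N : Matrix (Fin l) (Fin m) ℝ) :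
    toRat (M * N) = toRat M * toRat N :=
  Matrix.map_mul

theorem toRat_one {k : ℕ} : toRat (1 : Matrix (Fin k) (Fin k) ℝ) = 1 :=
  Matrix.map_one _ (map_zero _) (map_one _)

theorem toRat_pow {k : ℕ} (M : Matrix (Fin k) (Fin k) ℝ) (j : ℕ) :
    toRat (M ^ j) = toRat M ^ j := by
  induction j with
  | zero => simp [toRat_one]
  | succ j ih => rw [pow_succ, pow_succ, toRat_mul, ih]

theorem toRat_row_eq_zero {k l : ℕ} {M : Matrix (Fin k) (Fin l) ℝ} {i : Fin k} (h : M i = 0) :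
    toRat M i = 0 := by
  funext j
  simp [toRat, h]

theorem isUnit_det_sIm {k : ℕ} (M : Matrix (Fin k) (Fin k) ℝ) : IsUnit (sIm M).det := by
  have h : sIm M = (algebraMap (Polynomial ℝ) (RatFunc ℝ)).mapMatrix M.charmatrix := by
    ext i j
    by_cases hij : i = j
    · subst hij
      simp [sIm, toRat, charmatrix_apply_eq, RatFunc.algebraMap_X]
    · simp [sIm, toRat, charmatrix_apply_ne, hij]
  rw [h, ← RingHom.map_det, isUnit_iff_ne_zero]
  exact (map_ne_zero_iff _ (RatFunc.algebraMap_injective ℝ)).2 M.charpoly_monic.ne_zero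

theorem X_smul_inv_sIm {k : ℕ} (M : Matrix (Fin k) (Fin k) ℝ) :
    (RatFunc.X : RatFunc ℝ) • (sIm M)⁻¹ = 1 + toRat M * (sIm M)⁻¹ := by
  have h := Matrix.mul_nonsing_inv _ (isUnit_det_sIm M)
  nth_rewrite 1 [sIm] at h
  rw [Matrix.sub_mul, sub_eq_iff_eq_add] at h
  rw [← h, Matrix.scalar_apply, ← Matrix.smul_eq_diagonal_mul]

theorem add_row {R : Type*} [Add R] {k l : ℕ} (M N : Matrix (Fin k) (Fin l) R) (i : Fin k) :
    (M + N) i = M i + N i :=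
  rfl

theorem mul_row_eq_zero {R : Type*} [Semiring R] {k l m : ℕ} {M : Matrix (Fin k) (Fin l) R}
    {i : Fin k} (h : M i = 0) (N : Matrix (Fin l) (Fin m) R) : (M * N) i = 0 := by
  rw [Matrix.mul_apply_eq_vecMul, h, Matrix.zero_vecMul]

/-- One step of the expansion of a row of the transfer function in powers of `s⁻¹`. -/
theorem X_smul_transfer {n p q : ℕ} (M : Matrix (Fin n) (Fin n) ℝ) (B : Matrix (Fin n) (Fin p) ℝ)
    (C : Matrix (Fin q) (Fin n) ℝ) (k : ℕ) :
    (RatFunc.X : RatFunc ℝ) • (toRat (C * M ^ k) * (sIm M)⁻¹ * toRat B) =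
      toRat (C * M ^ k * B) + toRat (C * M ^ (k + 1)) * (sIm M)⁻¹ * toRat B := by
  rw [← Matrix.smul_mul, ← Matrix.mul_smul, X_smul_inv_sIm, Matrix.mul_add, Matrix.add_mul,
    Matrix.mul_one, toRat_mul (C * M ^ k) B, pow_succ, ← Matrix.mul_assoc C,
    toRat_mul (C * M ^ k) M]
  simp only [Matrix.mul_assoc]

/-- If the first `m` Markov parameters of output `i` vanish, then `s ^ m` times row `i` of the
transfer function is again a transfer function. -/
theorem X_pow_smul_transfer_row {n p q : ℕ} (M : Matrix (Fin n) (Fin n) ℝ)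
    (B : Matrix (Fin n) (Fin p) ℝ) (C : Matrix (Fin q) (Fin n) ℝ) (i : Fin q) (m : ℕ)
    (h : ∀ k < m, (C * M ^ k * B) i = 0) :
    (RatFunc.X : RatFunc ℝ) ^ m • (toRat C * (sIm M)⁻¹ * toRat B) i =
      (toRat (C * M ^ m) * (sIm M)⁻¹ * toRat B) i := by
  induction m with
  | zero => simp
  | succ m ih =>
    rw [pow_succ', mul_smul, ih fun k hk => h k (hk.trans m.lt_succ_self)]
    have := congrFun (X_smul_transfer M B C m) i
    rw [add_row, toRat_row_eq_zero (h m m.lt_succ_self), zero_add] at this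
    exact this

theorem X_pow_succ_smul_transfer_row {n p q : ℕ} (M : Matrix (Fin n) (Fin n) ℝ)
    (B : Matrix (Fin n) (Fin p) ℝ) (C : Matrix (Fin q) (Fin n) ℝ) (i : Fin q) (m : ℕ)
    (h : ∀ k < m, (C * M ^ k * B) i = 0) :
    (RatFunc.X : RatFunc ℝ) ^ (m + 1) • (toRat C * (sIm M)⁻¹ * toRat B) i =
      toRat (C * M ^ m * B) i + (toRat (C * M ^ (m + 1)) * (sIm M)⁻¹ * toRat B) i := by
  rw [pow_succ', mul_smul, X_pow_smul_transfer_row M B C i m h]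
  exact congrFun (X_smul_transfer M B C m) i

/-- State feedback does not change the rows `Cᵢ A ^ k` up to the relative order. -/
theorem feedback_row {n p q : ℕ} (A : Matrix (Fin n) (Fin n) ℝ) (B : Matrix (Fin n) (Fin p) ℝ)
    (C : Matrix (Fin q) (Fin n) ℝ) (F : Matrix (Fin p) (Fin n) ℝ) (i : Fin q) (m : ℕ)
    (h : ∀ k < m, (C * A ^ k * B) i = 0) :
    (C * (A + B * F) ^ m) i = (C * A ^ m) i := by
  induction m with
  | zero => simp
  | succ m ih =>
    rw [pow_succ, ← Matrix.mul_assoc, Matrix.mul_apply_eq_vecMul,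
      ih fun k hk => h k (hk.trans m.lt_succ_self), ← Matrix.mul_apply_eq_vecMul, Matrix.mul_add,
      ← Matrix.mul_assoc, add_row, mul_row_eq_zero (h m m.lt_succ_self), add_zero,
      pow_succ, Matrix.mul_assoc]

theorem feedback_markov_row {n p q : ℕ} (A : Matrix (Fin n) (Fin n) ℝ)
    (B : Matrix (Fin n) (Fin p) ℝ) (C : Matrix (Fin q) (Fin n) ℝ) (F : Matrix (Fin p) (Fin n) ℝ)
    (i : Fin q) (m : ℕ) (h : ∀ k < m, (C * A ^ k * B) i = 0) :
    (C * (A + B * F) ^ m * B) i = (C * A ^ m * B) i := by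
  rw [Matrix.mul_apply_eq_vecMul, feedback_row A B C F i m h, ← Matrix.mul_apply_eq_vecMul]

/-- By Cayley–Hamilton, the vanishing of the first `n` Markov parameters forces all to vanish. -/
theorem markov_row_eq_zero {n p q : ℕ} (M : Matrix (Fin n) (Fin n) ℝ)
    (B : Matrix (Fin n) (Fin p) ℝ) (C : Matrix (Fin q) (Fin n) ℝ) (i : Fin q) (hn : 0 < n)
    (h : ∀ k < n, (C * M ^ k * B) i = 0) (k : ℕ) : (C * M ^ k * B) i = 0 := by
  have hdeg : ((Polynomial.X ^ k : Polynomial ℝ) %ₘ M.charpoly).natDegree < n := by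
    have := Polynomial.natDegree_modByMonic_lt (Polynomial.X ^ k : Polynomial ℝ) M.charpoly_monic
      (fun h1 => by
        have := M.charpoly_natDegree_eq_dim
        rw [h1] at this
        simp at this
        omega)
    simpa using this
  rw [Matrix.pow_eq_aeval_mod_charpoly, Polynomial.aeval_eq_sum_range' hdeg, Matrix.mul_sum,
    Matrix.sum_mul]
  funext j
  rw [Matrix.sum_apply]
  refine Finset.sum_eq_zero fun l hl => ?_
  rw [Matrix.mul_smul, Matrix.smul_mul, Matrix.smul_apply,
    congrFun (h l (Finset.mem_range.1 hl)) j, Pi.zero_apply, smul_zero]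

open Classical in
theorem inftyValuation_algebraMap_le_one (r : ℝ) :
    RatFunc.inftyValuation ℝ (algebraMap ℝ (RatFunc ℝ) r) ≤ 1 := by
  rcases eq_or_ne r 0 with rfl | hr
  · simp
  · rw [RatFunc.algebraMap_eq_C, RatFunc.inftyValuation.C ℝ hr]

open Classical in
/-- The resolvent is strictly proper. -/
theorem inftyValuation_inv_sIm_lt_one {k : ℕ} (M : Matrix (Fin k) (Fin k) ℝ) (i j : Fin k) :
    RatFunc.inftyValuation ℝ ((sIm M)⁻¹ i j) < 1 := by
  set v := RatFunc.inftyValuation ℝ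
  obtain ⟨i₀, -, hmax⟩ := Finset.exists_max_image Finset.univ (fun i => v ((sIm M)⁻¹ i j))
    ⟨i, Finset.mem_univ i⟩
  refine (hmax i (Finset.mem_univ i)).trans_lt ?_
  by_contra! hge
  have hX : 1 < v RatFunc.X := by
    rw [RatFunc.inftyValuation.X, ← WithZero.exp_zero, WithZero.exp_lt_exp]
    exact one_pos
  have hstep := congrFun (congrFun (X_smul_inv_sIm M) i₀) j
  rw [Matrix.smul_apply, smul_eq_mul, Matrix.add_apply, Matrix.mul_apply] at hstep
  have hle : v (RatFunc.X * (sIm M)⁻¹ i₀ j) ≤ v ((sIm M)⁻¹ i₀ j) := by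
    rw [hstep]
    refine v.map_add_le ?_ (v.map_sum_le fun l _ => ?_)
    · refine le_trans ?_ hge
      rw [Matrix.one_apply]
      split_ifs <;> simp
    · rw [map_mul]
      exact mul_le_of_le_one_of_le (inftyValuation_algebraMap_le_one _)
        (hmax l (Finset.mem_univ l))
  rw [map_mul] at hle
  exact hle.not_gt ((lt_mul_iff_one_lt_left (zero_lt_one.trans_le hge)).2 hX)

open Classical in
/-- Every transfer function of a state-space system is strictly proper. -/
theorem inftyValuation_transfer_lt_one {n p q : ℕ} (M : Matrix (Fin n) (Fin n) ℝ)
    (B : Matrix (Fin n) (Fin p) ℝ) (C : Matrix (Fin q) (Fin n) ℝ) (i : Fin q) (j : Fin p) :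
    RatFunc.inftyValuation ℝ ((toRat C * (sIm M)⁻¹ * toRat B) i j) < 1 := by
  rw [Matrix.mul_apply]
  refine Valuation.map_sum_lt _ one_ne_zero fun l _ => ?_
  rw [map_mul]
  refine (mul_le_of_le_one_right' (inftyValuation_algebraMap_le_one _)).trans_lt ?_
  rw [Matrix.mul_apply]
  refine Valuation.map_sum_lt _ one_ne_zero fun l' _ => ?_
  rw [map_mul]
  exact (mul_le_of_le_one_left' (inftyValuation_algebraMap_le_one _)).trans_lt
    (inftyValuation_inv_sIm_lt_one M _ _)

open Classical in
theorem eq_zero_of_inftyValuation_algebraMap_lt_one {r : ℝ}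
    (h : RatFunc.inftyValuation ℝ (algebraMap ℝ (RatFunc ℝ) r) < 1) : r = 0 := by
  by_contra hr
  rw [RatFunc.algebraMap_eq_C, RatFunc.inftyValuation.C ℝ hr] at h
  exact h.false

/-- The first possibly nonzero Markov parameter of a decoupled output has no
off-diagonal entries. -/
theorem decoupled_markov_apply_ne {n p : ℕ} (M : Matrix (Fin n) (Fin n) ℝ)
    (B : Matrix (Fin n) (Fin p) ℝ) (C : Matrix (Fin p) (Fin n) ℝ) (δ : Fin p → ℕ)
    (hdec : toRat C * (sIm M)⁻¹ * toRat B =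
      Matrix.diagonal fun i => ((RatFunc.X : RatFunc ℝ) ^ δ i)⁻¹)
    (i j : Fin p) (hij : i ≠ j) (m : ℕ) (h : ∀ k < m, (C * M ^ k * B) i = 0) :
    (C * M ^ m * B) i j = 0 := by
  classical
  have hrow := congrFun (X_pow_succ_smul_transfer_row M B C i m h) j
  rw [hdec, Pi.smul_apply, Matrix.diagonal_apply_ne _ hij, smul_zero, Pi.add_apply] at hrow
  apply eq_zero_of_inftyValuation_algebraMap_lt_one
  have hval := inftyValuation_transfer_lt_one M B (C * M ^ (m + 1)) i j
  rw [← neg_eq_of_add_eq_zero_right hrow.symm, Valuation.map_neg] at hval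
  exact hval

/-- Some Markov parameter of a decoupled output is nonzero. -/
theorem exists_markov_row_ne_zero {n p : ℕ} (M : Matrix (Fin n) (Fin n) ℝ)
    (B : Matrix (Fin n) (Fin p) ℝ) (C : Matrix (Fin p) (Fin n) ℝ) (δ : Fin p → ℕ)
    (hdec : toRat C * (sIm M)⁻¹ * toRat B =
      Matrix.diagonal fun i => ((RatFunc.X : RatFunc ℝ) ^ δ i)⁻¹) (i : Fin p) :
    ∃ k : ℕ, (C * M ^ k * B) i ≠ 0 := by
  classical
  by_contra! h
  have hrow := congrFun (X_pow_smul_transfer_row M B C i (δ i) fun k _ => h k) i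
  rw [hdec, Pi.smul_apply, Matrix.diagonal_apply_eq, smul_eq_mul,
    mul_inv_cancel₀ (pow_ne_zero _ RatFunc.X_ne_zero)] at hrow
  have hval := inftyValuation_transfer_lt_one M B (C * M ^ δ i) i i
  rw [← hrow, map_one] at hval
  exact hval.false

/-- Falb–Wolovich criterion (Proposition 2.7, full equivalence), regular case `m = p`.
Here `d i` is the relative order of output `i`: the least `j ∈ {1,…,n}` with
`Cᵢ A^(j-1) B ≠ 0`, with the convention `d i = n` when `Cᵢ A^(j-1) B = 0` for all `j`.
There exist `F`, invertible `G` and positive integers `δ i` decoupling the system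
(closed loop `diag (s^{-δ 1}, …, s^{-δ p})`) iff `det B* ≠ 0`. -/
theorem falb_wolovich_criterion
    (n p : ℕ) (A : Matrix (Fin n) (Fin n) ℝ) (B : Matrix (Fin n) (Fin p) ℝ)
    (C : Matrix (Fin p) (Fin n) ℝ) (d : Fin p → ℕ)
    (hd1 : ∀ i, 1 ≤ d i) (hdn : ∀ i, d i ≤ n)
    (hdmin : ∀ i, ∀ j, 1 ≤ j → j < d i → (fun l => (C * A ^ (j - 1) * B) i l) = 0)
    (hdlast : ∀ i, (fun l => (C * A ^ (d i - 1) * B) i l) ≠ 0 ∨ d i = n)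
    (Bstar : Matrix (Fin p) (Fin p) ℝ)
    (hBstar : Bstar = Matrix.of fun i j => (C * A ^ (d i - 1) * B) i j) :
    (∃ (F : Matrix (Fin p) (Fin n) ℝ) (G : Matrix (Fin p) (Fin p) ℝ) (δ : Fin p → ℕ),
        IsUnit G.det ∧ (∀ i, 1 ≤ δ i) ∧
        toRat C * (sIm (A + B * F))⁻¹ * toRat B * toRat G =
          Matrix.diagonal fun i => ((RatFunc.X : RatFunc ℝ) ^ δ i)⁻¹) ↔
      Bstar.det ≠ 0 := by
  have hmarkov : ∀ i, ∀ k < d i - 1, (C * A ^ k * B) i = 0 := fun i k hk =>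
    hdmin i (k + 1) (by omega) (by omega)
  have hBrow : ∀ i, Bstar i = (C * A ^ (d i - 1) * B) i := fun i => by rw [hBstar]; rfl
  constructor
  · rintro ⟨F, G, δ, hG, -, hdec⟩
    set M := A + B * F with hM
    have hzero : ∀ (i : Fin p) (k : ℕ), (C * M ^ k * B) i = 0 →
        (C * M ^ k * (B * G)) i = 0 := fun i k hk => by
      rw [← Matrix.mul_assoc]
      exact mul_row_eq_zero hk G
    have hfeed : ∀ i, ∀ k ≤ d i - 1, (C * M ^ k * B) i = (C * A ^ k * B) i := fun i k hk =>
      feedback_markov_row A B C F i k fun l hl => hmarkov i l (by omega)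
    have hM0 : ∀ i, ∀ k < d i - 1, (C * M ^ k * B) i = 0 := fun i k hk => by
      rw [hfeed i k hk.le, hmarkov i k hk]
    rw [Matrix.mul_assoc, ← toRat_mul] at hdec
    have hrow : ∀ i, (Bstar * G) i = (C * M ^ (d i - 1) * (B * G)) i := fun i => by
      rw [← Matrix.mul_assoc, Matrix.mul_apply_eq_vecMul, Matrix.mul_apply_eq_vecMul _ G,
        hBrow, hfeed i _ le_rfl]
    have hdiag : Bstar * G = Matrix.diagonal fun i => (Bstar * G) i i := by
      ext i j
      by_cases hij : i = j
      · subst hij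
        rw [Matrix.diagonal_apply_eq]
      · rw [Matrix.diagonal_apply_ne _ hij, hrow]
        exact decoupled_markov_apply_ne M (B * G) C δ hdec i j hij _ fun k hk =>
          hzero i k (hM0 i k hk)
    have hne : ∀ i, (Bstar * G) i i ≠ 0 := by
      intro i hi
      have hBG : (Bstar * G) i = 0 := by
        rw [hdiag]
        funext j
        by_cases hij : i = j
        · subst hij
          rw [Matrix.diagonal_apply_eq, hi, Pi.zero_apply]
        · rw [Matrix.diagonal_apply_ne _ hij, Pi.zero_apply]
      have hB0 : Bstar i = 0 := by
        rw [← Matrix.mul_nonsing_inv_cancel_right G Bstar hG]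
        exact mul_row_eq_zero hBG _
      have hdi : d i = n := (hdlast i).resolve_left (not_not_intro ((hBrow i).symm.trans hB0))
      have hn : 0 < n := hdi ▸ hd1 i
      have hall := markov_row_eq_zero M B C i hn fun k hk => by
        rcases Nat.lt_or_ge k (d i - 1) with hlt | hge
        · exact hM0 i k hlt
        · obtain rfl : k = d i - 1 := by omega
          rw [hfeed i _ le_rfl, ← hBrow, hB0]
      obtain ⟨k, hk⟩ := exists_markov_row_ne_zero M (B * G) C δ hdec i
      exact hk (hzero i k (hall k))
    have hdet : (Bstar * G).det ≠ 0 := by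
      rw [hdiag, Matrix.det_diagonal]
      exact Finset.prod_ne_zero_iff.2 fun i _ => hne i
    rw [Matrix.det_mul] at hdet
    exact left_ne_zero_of_mul hdet
  · intro hdet
    have hunit : IsUnit Bstar.det := isUnit_iff_ne_zero.2 hdet
    set D : Matrix (Fin p) (Fin n) ℝ := Matrix.of fun i => (C * A ^ d i) i with hD
    set F := -(Bstar⁻¹ * D) with hF
    refine ⟨F, Bstar⁻¹, d, Bstar.isUnit_nonsing_inv_det hunit, hd1, ?_⟩
    have hBF : Bstar * F = -D := by
      rw [hF, Matrix.mul_neg, Matrix.mul_nonsing_inv_cancel_left _ _ hunit]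
    rw [Matrix.mul_assoc, ← toRat_mul]
    ext i j
    have hd : d i - 1 + 1 = d i := Nat.sub_add_cancel (hd1 i)
    have hnil : (C * (A + B * F) ^ d i) i = 0 := by
      rw [← hd, pow_succ, ← Matrix.mul_assoc, Matrix.mul_apply_eq_vecMul,
        feedback_row A B C F i _ (hmarkov i), ← Matrix.mul_apply_eq_vecMul, Matrix.mul_add,
        ← Matrix.mul_assoc, add_row, Matrix.mul_apply_eq_vecMul _ F, ← hBrow,
        ← Matrix.mul_apply_eq_vecMul, hBF, Matrix.mul_assoc, ← pow_succ, hd]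
      exact add_neg_cancel _
    have hrow := congrFun (X_pow_succ_smul_transfer_row (A + B * F) (B * Bstar⁻¹) C i (d i - 1)
      fun k hk => by
        rw [← Matrix.mul_assoc]
        refine mul_row_eq_zero ?_ _
        rw [feedback_markov_row A B C F i k fun l hl => hmarkov i l (hl.trans hk),
          hmarkov i k hk]) j
    have hone : (C * (A + B * F) ^ (d i - 1) * (B * Bstar⁻¹)) i = (1 : Matrix _ _ ℝ) i := by
      rw [← Matrix.mul_assoc, Matrix.mul_apply_eq_vecMul,
        feedback_markov_row A B C F i _ (hmarkov i), ← hBrow, ← Matrix.mul_apply_eq_vecMul,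
        Matrix.mul_nonsing_inv _ hunit]
    have hX : (RatFunc.X : RatFunc ℝ) ^ d i ≠ 0 := pow_ne_zero _ RatFunc.X_ne_zero
    rw [hd, Pi.smul_apply, Pi.add_apply, smul_eq_mul,
      mul_row_eq_zero (mul_row_eq_zero (toRat_row_eq_zero hnil) _), Pi.zero_apply, add_zero] at hrow
    have hentry : toRat (C * (A + B * F) ^ (d i - 1) * (B * Bstar⁻¹)) i j =
        (1 : Matrix _ _ (RatFunc ℝ)) i j := by
      rw [← toRat_one]
      exact congrArg (algebraMap ℝ (RatFunc ℝ)) (congrFun hone j)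
    rw [hentry] at hrow
    rw [(eq_inv_mul_iff_mul_eq₀ hX).2 hrow, Matrix.one_apply, Matrix.diagonal_apply]
    split_ifs <;> simp
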